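/- arXiv:2410.16968 — 2 statements merged into one kernel-verified Lean document; each statement's English description precedes it below -/
import Mathlib

section
/- Let k ≥ w ≥ 1 and let v be a string of length w+k that contains two equal k-substrings at distinct positions. Then every occurrence in v of a k-substring that occurs more than once in v lies entirely inside the (unique) major run of v. -/
open Finset

/-- The `i`-th length-`k` substring (`k`-mer) of a word of length `w + k`
over the alphabet `Fin σ`. -/
def kmerAt (σ k w : ℕ) (v : Fin (w + k) → Fin σ) (i : Fin (w + 1)) : Fin k → Fin σ :=
  fun j => v ⟨i.1 + j.1, by have h1 := i.2; have h2 := j.2; omega⟩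

/-- `v` is a gamechanger with respect to the linear order (ranking) `ρ` on `k`-mers:
either its `k`-prefix is a `ρ`-minimal `k`-mer of `v`, or its `k`-suffix is a
`ρ`-minimal `k`-mer of `v` occurring exactly once in `v`. -/
def IsGC (σ k w : ℕ) (ρ : (Fin k → Fin σ) ≃ Fin (σ ^ k)) (v : Fin (w + k) → Fin σ) : Prop :=
  (∀ i : Fin (w + 1), ρ (kmerAt σ k w v 0) ≤ ρ (kmerAt σ k w v i)) ∨
  ((∀ i : Fin (w + 1), ρ (kmerAt σ k w v (Fin.last w)) ≤ ρ (kmerAt σ k w v i)) ∧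
    (∀ i : Fin (w + 1), kmerAt σ k w v i = kmerAt σ k w v (Fin.last w) → i = Fin.last w))

/-- `P_{σ,k}(v)`: the fraction of linear orders `ρ` on `σ`-ary `k`-strings for which
`v` is a gamechanger. -/
noncomputable def Pgc (σ k w : ℕ) (v : Fin (w + k) → Fin σ) : ℝ :=
  (Nat.card {ρ : (Fin k → Fin σ) ≃ Fin (σ ^ k) // IsGC σ k w ρ v} : ℝ) /
    (Nat.card ((Fin k → Fin σ) ≃ Fin (σ ^ k)) : ℝ)

/-- `D_ρ`: the fraction of gamechangers among all `σ`-ary strings of length `w + k`. -/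
noncomputable def Dens (σ k w : ℕ) (ρ : (Fin k → Fin σ) ≃ Fin (σ ^ k)) : ℝ :=
  (Nat.card {v : Fin (w + k) → Fin σ // IsGC σ k w ρ v} : ℝ) / ((σ : ℝ) ^ (w + k))

/-- `DR_σ(k,w)`: the expected density, i.e. the average of `D_ρ` over all orders `ρ`. -/
noncomputable def DR (σ k w : ℕ) : ℝ :=
  (∑ ρ : (Fin k → Fin σ) ≃ Fin (σ ^ k), Dens σ k w ρ) /
    (Nat.card ((Fin k → Fin σ) ≃ Fin (σ ^ k)) : ℝ)

/-- `DFR_σ(k,w) = (w+1) · DR_σ(k,w)`, the expected density factor. -/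
noncomputable def DFR (σ k w : ℕ) : ℝ := ((w : ℝ) + 1) * DR σ k w

/-- The number of distinct `k`-mers of `v`. -/
def numKmers (σ k w : ℕ) (v : Fin (w + k) → Fin σ) : ℕ :=
  (Finset.univ.image (kmerAt σ k w v)).card

/-- `Rep_{σ,k,w}`: the set of `σ`-ary strings of length `w + k` that contain two equal
`k`-substrings at distinct positions. -/
def RepSet (σ k w : ℕ) : Finset (Fin (w + k) → Fin σ) :=
  Finset.univ.filter fun v =>
    ∃ i j : Fin (w + 1), i ≠ j ∧ kmerAt σ k w v i = kmerAt σ k w v j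

/-- `Dev_σ(k,w)`, the deviation of the random order. -/
noncomputable def Dev (σ k w : ℕ) : ℝ :=
  (∑ v ∈ RepSet σ k w, Pgc σ k w v) - (2 / ((w : ℝ) + 1)) * ((RepSet σ k w).card : ℝ)

/-- `p` is a period of the string `s` (of length `n`): `s[i] = s[i+p]` whenever both
positions are inside `s`. -/
def HasPeriod (σ n : ℕ) (s : Fin n → Fin σ) (p : ℕ) : Prop :=
  ∀ (i : ℕ) (h : i + p < n), s ⟨i, by omega⟩ = s ⟨i + p, h⟩

/-- A string is primitive if it is not of the form `u^m` with `m ≥ 2`, equivalently it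
has no period that is a proper divisor of its length. -/
def IsPrimitive (σ n : ℕ) (s : Fin n → Fin σ) : Prop :=
  ¬ ∃ d, d ∣ n ∧ d < n ∧ HasPeriod σ n s d

/-- `Prim_σ(n)`: the number of primitive `σ`-ary strings of length `n`. -/
noncomputable def Prim (σ n : ℕ) : ℕ :=
  Nat.card {s : Fin n → Fin σ // IsPrimitive σ n s}

/-- The substring of `v` of length `ℓ` starting at (0-indexed) position `i`. -/
def subAt (σ n : ℕ) (v : Fin n → Fin σ) (i ℓ : ℕ) (h : i + ℓ ≤ n) : Fin ℓ → Fin σ :=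
  fun j => v ⟨i + j.1, by have := j.2; omega⟩

/-- A string is `p`-periodic if `p` is its minimal period and `p ≤ |s|/2`. -/
def IsPPeriodic (σ n : ℕ) (s : Fin n → Fin σ) (p : ℕ) : Prop :=
  1 ≤ p ∧ 2 * p ≤ n ∧ HasPeriod σ n s p ∧ ∀ q, 1 ≤ q → q < p → ¬ HasPeriod σ n s q

/-- The occurrence `v[i..i+ℓ)` is a run of period `p`: it is `p`-periodic and is not
contained in a longer `p`-periodic substring of `v`. -/
def IsRun (σ n : ℕ) (v : Fin n → Fin σ) (i ℓ p : ℕ) (h : i + ℓ ≤ n) : Prop :=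
  IsPPeriodic σ ℓ (subAt σ n v i ℓ h) p ∧
    ∀ (i' ℓ' : ℕ) (h' : i' + ℓ' ≤ n), i' ≤ i → i + ℓ ≤ i' + ℓ' → ℓ < ℓ' →
      ¬ IsPPeriodic σ ℓ' (subAt σ n v i' ℓ' h') p

/-- A major run: a run `x` of period `p` with `|x| ≥ |v|/2 + p`. -/
def IsMajorRun (σ n : ℕ) (v : Fin n → Fin σ) (i ℓ p : ℕ) (h : i + ℓ ≤ n) : Prop :=
  IsRun σ n v i ℓ p h ∧ n + 2 * p ≤ 2 * ℓ

/-- `f` has period `p` on the interval `[s, e)`. -/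
def PerOn (f : ℕ → ℕ) (s e p : ℕ) : Prop := ∀ x, s ≤ x → x + p < e → f x = f (x + p)

theorem PerOn.mul {f : ℕ → ℕ} {s e q : ℕ} (h : PerOn f s e q) (x : ℕ) (hx : s ≤ x) (m : ℕ) :
    x + q * m < e → f x = f (x + q * m) := by
  induction m with
  | zero => intro _; simp
  | succ m ih =>
    intro h1
    rw [Nat.mul_succ] at h1 ⊢
    rw [ih (by omega), h (x + q * m) (by omega) (by omega), add_assoc]

theorem PerOn.modEq_le {f : ℕ → ℕ} {s e q x y : ℕ} (h : PerOn f s e q) (hx : s ≤ x) (hy : y < e)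
    (hxy : x ≤ y) (hm : x ≡ y [MOD q]) : f x = f y := by
  obtain ⟨m, hm⟩ := (Nat.modEq_iff_dvd' hxy).1 hm
  have : y = x + q * m := by omega
  subst this
  exact h.mul x hx m hy

theorem PerOn.modEq {f : ℕ → ℕ} {s e q x y : ℕ} (h : PerOn f s e q) (hx : s ≤ x) (hx' : x < e)
    (hy' : s ≤ y) (hy : y < e) (hm : x ≡ y [MOD q]) : f x = f y := by
  rcases le_total x y with hxy | hxy
  · exact h.modEq_le hx hy hxy hm
  · exact (h.modEq_le hy' hx' hxy hm.symm).symm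

theorem exists_rep (c q x : ℕ) (hq : 1 ≤ q) : ∃ r, c ≤ r ∧ r < c + q ∧ r ≡ x [MOD q] := by
  refine ⟨c + (x + c * q - c) % q, by omega, ?_, ?_⟩
  · have := Nat.mod_lt (x + c * q - c) hq
    omega
  · have h1 : c ≤ c * q := Nat.le_mul_of_pos_right c hq
    have h2 : c + (x + c * q - c) % q ≡ c + (x + c * q - c) [MOD q] :=
      Nat.ModEq.add_left _ (Nat.mod_modEq _ _)
    have h3 : c + (x + c * q - c) = x + c * q := by omega
    rw [h3] at h2
    refine h2.trans ?_
    simp [Nat.ModEq]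

theorem fine_wilf {f : ℕ → ℕ} {s e : ℕ} : ∀ (N p q : ℕ), p + q ≤ N → 1 ≤ p → 1 ≤ q →
    s + (p + q) ≤ e → PerOn f s e p → PerOn f s e q → PerOn f s e (Nat.gcd p q) := by
  intro N
  induction N with
  | zero => intros; omega
  | succ N ih =>
    have key : ∀ p q, p + q ≤ N + 1 → 1 ≤ p → p < q → s + (p + q) ≤ e →
        PerOn f s e p → PerOn f s e q → PerOn f s e (Nat.gcd p q) := by
      intro p q hN hp hpq he h1 h2
      have h3 : PerOn f s e (q - p) := by
        intro x hx hxe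
        by_cases hc : x + q < e
        · rw [h2 x hx hc, h1 (x + (q - p)) (by omega) (by omega)]
          congr 1; omega
        · have e1 := h1 (x - p) (by omega) (by omega)
          have e2 := h2 (x - p) (by omega) (by omega)
          rw [show x - p + p = x by omega] at e1
          rw [show x - p + q = x + (q - p) by omega] at e2
          rw [← e1, e2]
      have := ih p (q - p) (by omega) hp (by omega) (by omega) h1 h3
      rwa [Nat.gcd_sub_self_right hpq.le] at this
    intro p q hN hp hq he h1 h2
    rcases lt_trichotomy p q with h | h | h
    · exact key p q hN hp h he h1 h2
    · subst h; rwa [Nat.gcd_self]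
    · rw [Nat.gcd_comm]; exact key q p (by omega) hq h (by omega) h2 h1

theorem PerOn.extend {f : ℕ → ℕ} {s e c d q g : ℕ} (h : PerOn f s e q) (hcd : PerOn f c d g)
    (hs : s ≤ c) (he : d ≤ e) (hq : 1 ≤ q) (hl : c + q ≤ d) (hg : g ∣ q) : PerOn f s e g := by
  intro x hx hxe
  obtain ⟨r, hr1, hr2, hr⟩ := exists_rep c q x hq
  obtain ⟨t, ht1, ht2, ht⟩ := exists_rep c q (x + g) hq
  rw [h.modEq hx (by omega) (by omega : s ≤ r) (by omega) hr.symm,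
    h.modEq (by omega : s ≤ x + g) (by omega) (by omega : s ≤ t) (by omega) ht.symm]
  refine hcd.modEq hr1 (by omega) ht1 (by omega) ?_
  refine (hr.of_dvd hg).trans (Nat.ModEq.trans ?_ (ht.of_dvd hg).symm)
  simp [Nat.ModEq]

theorem core {f : ℕ → ℕ} {n i ℓ p s e q : ℕ} (hrun : PerOn f i (i + ℓ) p) (hp : 1 ≤ p)
    (hmin : ∀ g, 1 ≤ g → g < p → ¬ PerOn f i (i + ℓ) g)
    (hn : i + ℓ ≤ n) (hen : e ≤ n) (hq : 1 ≤ q) (hX : PerOn f s e q) (hse : s + q ≤ e)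
    (hpl : p ≤ ℓ) (hov1 : n + p + q ≤ ℓ + (e - s)) :
    PerOn f (min i s) (max (i + ℓ) e) p := by
  have hc : max i s + (p + q) ≤ min (i + ℓ) e := by omega
  have r1 : PerOn f (max i s) (min (i + ℓ) e) p := fun x hx hx' => hrun x (by omega) (by omega)
  have r2 : PerOn f (max i s) (min (i + ℓ) e) q := fun x hx hx' => hX x (by omega) (by omega)
  have r3 := fine_wilf _ p q le_rfl hp hq hc r1 r2
  have r4 : PerOn f i (i + ℓ) (Nat.gcd p q) :=
    hrun.extend r3 (by omega) (by omega) hp (by omega) (Nat.gcd_dvd_left p q)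
  have hg : Nat.gcd p q = p := by
    by_contra hne
    exact hmin _ (Nat.gcd_pos_of_pos_left q hp)
      (lt_of_le_of_ne (Nat.gcd_le_left q hp) hne) r4
  have r5 : PerOn f s e p :=
    hX.extend r1 (by omega) (by omega) hq (by omega) (Nat.gcd_eq_left_iff_dvd.1 hg)
  intro x hx hx'
  by_cases h1 : i ≤ x ∧ x + p < i + ℓ
  · exact hrun x h1.1 h1.2
  · exact r5 x (by omega) (by omega)

/-- Extension of a word by zeros. -/
def extW (σ n : ℕ) (v : Fin n → Fin σ) (x : ℕ) : ℕ := if h : x < n then (v ⟨x, h⟩).1 else 0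

theorem extW_eq {σ n : ℕ} (v : Fin n → Fin σ) {x y : ℕ} (hx : x < n) (hy : y < n) :
    extW σ n v x = extW σ n v y ↔ v ⟨x, hx⟩ = v ⟨y, hy⟩ := by
  simp [extW, hx, hy, Fin.ext_iff]

theorem hasPeriod_sub_iff {σ n : ℕ} (v : Fin n → Fin σ) (i ℓ p : ℕ) (h : i + ℓ ≤ n) :
    HasPeriod σ ℓ (subAt σ n v i ℓ h) p ↔ PerOn (extW σ n v) i (i + ℓ) p := by
  constructor
  · intro H x hx hx'
    rw [extW_eq v (by omega) (by omega)]
    have := H (x - i) (by omega)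
    simp only [subAt] at this
    convert this using 3 <;> omega
  · intro H x hx
    have := H (i + x) (by omega) (by omega)
    rw [extW_eq v (by omega) (by omega)] at this
    simp only [subAt]
    convert this using 3
    omega

theorem pair_inside (σ k w : ℕ) (hwk : w ≤ k) (v : Fin (w + k) → Fin σ)
    (i ℓ p : ℕ) (h : i + ℓ ≤ w + k) (hM : IsMajorRun σ (w + k) v i ℓ p h)
    (a b : Fin (w + 1)) (hab : a.1 < b.1) (heq : kmerAt σ k w v a = kmerAt σ k w v b) :
    i ≤ a.1 ∧ b.1 + k ≤ i + ℓ := by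
  obtain ⟨⟨⟨hp, h2p, hper, hmin⟩, hmax⟩, hmaj⟩ := hM
  rw [hasPeriod_sub_iff] at hper
  have hb := b.2
  have hX : PerOn (extW σ (w + k) v) a.1 (b.1 + k) (b.1 - a.1) := by
    intro x hx hx'
    rw [extW_eq v (by omega) (by omega)]
    have := congrFun heq ⟨x - a.1, by omega⟩
    simp only [kmerAt] at this
    convert this using 3 <;> omega
  have hU := core (n := w + k) hper hp
    (fun g h1 h2 h3 => hmin g h1 h2 ((hasPeriod_sub_iff v i ℓ g h).2 h3))
    h (by omega) (by omega) hX (by omega) (by omega) (by omega)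
  by_contra hcon
  have hle : min i a.1 + (max (i + ℓ) (b.1 + k) - min i a.1) = max (i + ℓ) (b.1 + k) := by omega
  refine hmax (min i a.1) (max (i + ℓ) (b.1 + k) - min i a.1) (by omega) (by omega) (by omega)
    (by omega) ⟨hp, by omega, ?_, ?_⟩
  · rw [hasPeriod_sub_iff, hle]; exact hU
  · intro g h1 h2 h3
    rw [hasPeriod_sub_iff, hle] at h3
    refine hmin g h1 h2 ((hasPeriod_sub_iff v i ℓ g h).2 ?_)
    exact fun x hx hx' => h3 x (by omega) (by omega)

theorem stmt4 (σ k w : ℕ) (hw : 1 ≤ w) (hwk : w ≤ k) (v : Fin (w + k) → Fin σ)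
    (hrep : ∃ i j : Fin (w + 1), i ≠ j ∧ kmerAt σ k w v i = kmerAt σ k w v j) :
    ∀ (i ℓ p : ℕ) (h : i + ℓ ≤ w + k), IsMajorRun σ (w + k) v i ℓ p h →
      ∀ a : Fin (w + 1), (∃ b : Fin (w + 1), b ≠ a ∧ kmerAt σ k w v a = kmerAt σ k w v b) →
        i ≤ a.1 ∧ a.1 + k ≤ i + ℓ := by 
  intro i ℓ p h hM a ⟨b, hne, heq⟩
  have hne' : b.1 ≠ a.1 := fun hh => hne (Fin.ext hh)
  rcases lt_or_gt_of_ne hne' with hlt | hlt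
  · have := pair_inside σ k w hwk v i ℓ p h hM b a hlt heq.symm
    omega
  · have := pair_inside σ k w hwk v i ℓ p h hM a b hlt heq
    omega
end

section
/- Let σ ≥ 2 and 1 ≤ w ≤ k. Then Σ_{v ∈ Rep_{σ,k,w}} P_{σ,k}(v) = Σ_{t=1}^{w} (1/t)·( Prim_σ(t) + Σ_{p=1}^{t−1} Prim_σ(p)·σ^{t−p}·( 2t−2p+1 − (4t−4p−1)/σ + (2t−2p−2)/σ² ) ). -/
open Finset

def Per (V : ℕ → ℕ) (l r p : ℕ) : Prop := ∀ x, l ≤ x → x + p < r → V x = V (x + p)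

lemma per_mul {V : ℕ → ℕ} {l r p : ℕ} (h : Per V l r p) (m : ℕ) : Per V l r (m * p) := by
  induction m with
  | zero => intro x _ _; simp
  | succ m ih =>
    intro x h1 h2
    rw [Nat.succ_mul, ← Nat.add_assoc] at *
    rw [ih x h1 (by omega)]
    exact h _ (by omega) h2

lemma per_fw {V : ℕ → ℕ} {l r : ℕ} : ∀ (N p q : ℕ), p + q ≤ N → 0 < p → 0 < q → l + p + q ≤ r →
    Per V l r p → Per V l r q → Per V l r (Nat.gcd p q) := by
  have key : ∀ p q, q < p → l + p + q ≤ r → Per V l r p → Per V l r q → Per V l r (p - q) := by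
    intro p q hqp hr hp hq x h1 h2
    by_cases hx : x + p < r
    · rw [hp x h1 hx]
      have := hq (x + (p - q)) (by omega) (by omega)
      rw [this]; congr 1; omega
    · have e1 := hq (x - q) (by omega) (by omega)
      have e2 := hp (x - q) (by omega) (by omega)
      rw [show x - q + q = x by omega] at e1
      rw [show x - q + p = x + (p - q) by omega] at e2
      rw [← e1, e2]
  intro N
  induction N with
  | zero => intros; omega
  | succ N ih =>
    intro p q hN hp0 hq0 hr hp hq
    rcases lt_trichotomy p q with h | h | h
    · have := ih p (q - p) (by omega) hp0 (by omega) (by omega) hp (key q p h (by omega) hq hp)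
      rwa [Nat.gcd_sub_self_right h.le] at this
    · subst h; simpa using hp
    · have := ih (p - q) q (by omega) (by omega) hq0 (by omega) (key p q h (by omega) hp hq) hq
      rwa [Nat.gcd_sub_self_left h.le] at this

lemma per_ext {V : ℕ → ℕ} {l r p g c : ℕ} (hp0 : 0 < p) (h : Per V l r p) (hc : l ≤ c)
    (hcr : c + p + g ≤ r) (hg : Per V c (c + p + g) g) : Per V l r g := by
  have key : ∀ y x, c ≤ x → x < y → x + g < r → V x = V (x + g) := by
    intro y
    induction y with
    | zero => intros; omega
    | succ y ih =>
      intro x h1 h2 h3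
      by_cases hx : x < c + p
      · exact hg x h1 (by omega)
      · have e := ih (x - p) (by omega) (by omega) (by omega)
        have e1 := h (x - p) (by omega) (by omega)
        have e2 := h (x - p + g) (by omega) (by omega)
        rw [show x - p + p = x by omega] at e1
        rw [show x - p + g + p = x + g by omega] at e2
        rw [← e1, e, e2]
  have key2 : ∀ y x, c ≤ x + y → l ≤ x → x + g < r → V x = V (x + g) := by
    intro y
    induction y with
    | zero => intro x h1 h2 h3; exact key (x+1) x h1 (by omega) h3
    | succ y ih =>
      intro x h1 h2 h3
      by_cases hx : c ≤ x
      · exact key (x+1) x hx (by omega) h3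
      · have e := ih (x + p) (by omega) (by omega) (by omega)
        rw [h x h2 (by omega), e, h (x + g) (by omega) (by omega)]
        congr 1; omega
  intro x h1 h2
  exact key2 c x (by omega) h1 h2

lemma per_window {V : ℕ → ℕ} {a r p g : ℕ} (hgp : g ∣ p) (hp0 : 0 < p) (h : Per V a r p)
    (hr : a + p + g ≤ r) (hg : Per V a (a + p) g) : Per V a r g := by
  refine per_ext hp0 h le_rfl hr ?_
  intro x h1 h2
  by_cases hx : x + g < a + p
  · exact hg x h1 hx
  · obtain ⟨m, rfl⟩ := hgp
    have hle : g ≤ g * m := Nat.le_of_dvd hp0 (Dvd.intro m rfl)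
    have e1 := h (x + g - g * m) (by omega) (by omega)
    have e2 := per_mul hg (m - 1) (x + g - g * m) (by omega)
    have e3 : (m - 1) * g = g * m - g := by rw [Nat.sub_mul, mul_comm]; simp
    rw [e3] at e2
    have e2 := e2 (by omega)
    rw [show x + g - g * m + g * m = x + g by omega] at e1
    rw [show x + g - g * m + (g * m - g) = x by omega] at e2
    rw [← e2, e1]

structure Cnd (V : ℕ → ℕ) (k w p a d : ℕ) : Prop where
  pos : 1 ≤ p
  le : a + d + p ≤ w
  per : Per V a (w + k - d) p
  left : ∀ x, x + 1 = a → V x ≠ V (x + p)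
  right : ∀ x, x + p + d = w + k → 0 < d → V x ≠ V (x + p)
  prim : ¬ ∃ g, g ∣ p ∧ g < p ∧ Per V a (a + p) g

lemma cnd_key {V : ℕ → ℕ} {k w p a d : ℕ} (hwk : w ≤ k) (h : Cnd V k w p a d) {i j : ℕ}
    (hij : i < j) (hj : j ≤ w) (he : ∀ x, x < k → V (i + x) = V (j + x)) :
    a ≤ i ∧ j ≤ w - d ∧ p ∣ j - i := by
  obtain ⟨hp0, hle, hper, hl, hr, hprim⟩ := h
  obtain ⟨q, rfl⟩ : ∃ q, j = i + q := ⟨j - i, by omega⟩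
  have hY : Per V i (i + q + k) q := by
    intro x h1 h2
    have := he (x - i) (by omega)
    rw [show i + (x - i) = x by omega, show i + q + (x - i) = x + q by omega] at this
    exact this
  set L := max a i with hL
  set R := min (w + k - d) (i + q + k) with hR
  have hlen : L + p + q ≤ R := by omega
  have hZ : Per V L R (Nat.gcd p q) := by
    apply per_fw (p + q) p q le_rfl (by omega) (by omega) hlen
    · intro x h1 h2; exact hper x (by omega) (by omega)
    · intro x h1 h2; exact hY x (by omega) (by omega)
  have hgle : Nat.gcd p q ≤ q := Nat.gcd_le_right _ (by omega)
  have hgle' : Nat.gcd p q ≤ p := Nat.gcd_le_left _ (by omega)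
  have hX : Per V a (w + k - d) (Nat.gcd p q) := by
    apply per_ext (c := L) hp0 hper (by omega) (by omega)
    intro x h1 h2; exact hZ x h1 (by omega)
  have hgp : Nat.gcd p q = p := by
    by_contra hne
    exact hprim ⟨_, Nat.gcd_dvd_left p q, by omega, fun x h1 h2 => hX x h1 (by omega)⟩
  have hdvd : p ∣ q := by rw [← hgp]; exact Nat.gcd_dvd_right p q
  have hpq : p ≤ q := Nat.le_of_dvd (by omega) hdvd
  obtain ⟨m, hm⟩ := hdvd
  have hsub : (m - 1) * p = q - p := by rw [Nat.sub_mul, hm, mul_comm]; simp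
  have hX' := per_mul hper (m - 1)
  rw [hsub] at hX'
  refine ⟨?_, ?_, ?_⟩
  · by_contra hlt
    apply hl (a - 1) (by omega)
    rw [hY (a - 1) (by omega) (by omega), hX' (a - 1 + p) (by omega) (by omega)]
    congr 1; omega
  · by_contra hlt
    apply hr (w + k - d - p) (by omega) (by omega)
    have e1 := hY (w + k - d - q) (by omega) (by omega)
    have e2 := hX' (w + k - d - q) (by omega) (by omega)
    rw [show w + k - d - q + (q - p) = w + k - d - p by omega] at e2
    rw [← e2, e1]; congr 1; omega
  · exact ⟨m, by rw [← hm]; omega⟩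

lemma cnd_conv {V : ℕ → ℕ} {k w p a d : ℕ} (h : Cnd V k w p a d) {i m : ℕ}
    (hi : a ≤ i) (hj : i + m * p ≤ w - d) : ∀ x, x < k → V (i + x) = V (i + m * p + x) := by
  intro x hx
  have hle := h.le
  rw [per_mul h.per m (i + x) (by omega) (by omega)]
  congr 1; omega

lemma cnd_unique {V : ℕ → ℕ} {k w p a d p' a' d' : ℕ} (hwk : w ≤ k) (h : Cnd V k w p a d)
    (h' : Cnd V k w p' a' d') : p = p' ∧ a = a' ∧ d = d' := by
  have key : ∀ {p a d p' a' d' : ℕ}, Cnd V k w p a d → Cnd V k w p' a' d' →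
      a' ≤ a ∧ d' ≤ d ∧ p' ∣ p := by
    intro p a d p' a' d' h h'
    have h1 := h.pos
    have h2 := h.le
    have h2' := h'.le
    have c1 := cnd_conv h (i := a) (m := 1) le_rfl (by omega)
    have c2 := cnd_conv h (i := w - d - p) (m := 1) (by omega) (by omega)
    have k1 := cnd_key hwk h' (i := a) (j := a + 1 * p) (by omega) (by omega) c1
    have k2 := cnd_key hwk h' (i := w - d - p) (j := w - d - p + 1 * p) (by omega) (by omega) c2
    refine ⟨k1.1, by omega, ?_⟩
    have := k1.2.2
    rwa [show a + 1 * p - a = p by omega] at this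
  have k1 := key h h'
  have k2 := key h' h
  exact ⟨Nat.dvd_antisymm k2.2.2 k1.2.2, by omega, by omega⟩

lemma cnd_exists {V : ℕ → ℕ} {k w : ℕ} (hwk : w ≤ k) {i j : ℕ}
    (hij : i < j) (hj : j ≤ w) (he : ∀ x, x < k → V (i + x) = V (j + x)) :
    ∃ p a d, Cnd V k w p a d := by
  classical
  have hex : ∃ p, 0 < p ∧ ∃ i, i + p ≤ w ∧ ∀ x, x < k → V (i + x) = V (i + p + x) :=
    ⟨j - i, by omega, i, by omega, by rwa [show i + (j - i) = j by omega]⟩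
  obtain ⟨hp0, i, hi, he⟩ := Nat.find_spec hex
  have hmin := fun m hm => Nat.find_min (H := hex) (m := m) hm
  set p := Nat.find hex with hp
  have hper : Per V i (i + p + k) p := by
    intro x h1 h2
    have := he (x - i) (by omega)
    rw [show i + (x - i) = x by omega, show i + p + (x - i) = x + p by omega] at this
    exact this
  have hexd : ∃ d, Per V i (w + k - d) p :=
    ⟨w - (i + p), by rwa [show w + k - (w - (i + p)) = i + p + k by omega]⟩
  have hd1 := Nat.find_spec hexd
  have hd2 : Nat.find hexd ≤ w - (i + p) :=
    Nat.find_min' hexd (by rwa [show w + k - (w - (i + p)) = i + p + k by omega])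
  have hd3 := fun m hm => Nat.find_min (H := hexd) (m := m) hm
  set d := Nat.find hexd with hd
  have hexa : ∃ a, Per V a (w + k - d) p := ⟨i, hd1⟩
  have ha1 := Nat.find_spec hexa
  have ha2 : Nat.find hexa ≤ i := Nat.find_min' hexa hd1
  have ha3 := fun m hm => Nat.find_min (H := hexa) (m := m) hm
  set a := Nat.find hexa with ha
  refine ⟨p, a, d, hp0, by omega, ha1, ?_, ?_, ?_⟩
  · intro x hx hxe
    apply ha3 x (by omega)
    intro y h1 h2
    rcases Nat.eq_or_lt_of_le h1 with rfl | h
    · exact hxe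
    · exact ha1 y (by omega) h2
  · intro x hx hd0 hxe
    apply hd3 (d - 1) (by omega)
    intro y h1 h2
    by_cases hy : y + p < w + k - d
    · exact hd1 y h1 hy
    · obtain rfl : y = x := by omega
      exact hxe
  · rintro ⟨g, hgp, hlt, hg⟩
    have hg0 : 0 < g := Nat.pos_of_ne_zero (by rintro rfl; simp at hgp; omega)
    have hX := per_window hgp hp0 ha1 (by omega) hg
    apply hmin g hlt
    refine ⟨hg0, i, by omega, fun x hx => ?_⟩
    rw [hX (i + x) (by omega) (by omega)]
    congr 1; omega

def wext {σ n : ℕ} (v : Fin n → Fin σ) (x : ℕ) : ℕ := if h : x < n then (v ⟨x, h⟩).val else 0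

lemma wext_lt {σ n : ℕ} (v : Fin n → Fin σ) {x : ℕ} (h : x < n) : wext v x = (v ⟨x, h⟩).val := by
  simp [wext, h]

lemma kmer_eq_iff {σ k w : ℕ} (v : Fin (w + k) → Fin σ) (i j : Fin (w + 1)) :
    kmerAt σ k w v i = kmerAt σ k w v j ↔
      ∀ x, x < k → wext v (i.1 + x) = wext v (j.1 + x) := by
  have hi := i.2
  have hj := j.2
  constructor
  · intro h x hx
    have := congrFun h ⟨x, hx⟩
    rw [wext_lt v (show i.1 + x < w + k by omega), wext_lt v (show j.1 + x < w + k by omega)]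
    exact congrArg Fin.val this
  · intro h
    funext ⟨x, hx⟩
    have := h x hx
    rw [wext_lt v (show i.1 + x < w + k by omega), wext_lt v (show j.1 + x < w + k by omega)] at this
    exact Fin.ext this

lemma card_min {α : Type*} [Fintype α] [DecidableEq α] {N : ℕ} (M : Finset α) {x : α}
    (hx : x ∈ M) :
    Nat.card {ρ : α ≃ Fin N // ∀ y ∈ M, ρ x ≤ ρ y} * M.card = Nat.card (α ≃ Fin N) := by
  classical
  have hsymm : ∀ z ∈ M, (univ.filter fun ρ : α ≃ Fin N => ∀ y ∈ M, ρ z ≤ ρ y).card =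
      (univ.filter fun ρ : α ≃ Fin N => ∀ y ∈ M, ρ x ≤ ρ y).card := by
    intro z hz
    have hsw : ∀ y ∈ M, Equiv.swap x z y ∈ M := by
      intro y hy
      rw [Equiv.swap_apply_def]
      split_ifs <;> assumption
    refine Finset.card_nbij' (fun ρ => (Equiv.swap x z).trans ρ) (fun ρ => (Equiv.swap x z).trans ρ)
      ?_ ?_ ?_ ?_
    · intro ρ hρ
      simp only [coe_filter, mem_univ, true_and, Set.mem_ofPred_eq, Equiv.trans_apply,
        Equiv.swap_apply_left] at hρ ⊢
      exact fun y hy => hρ _ (hsw y hy)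
    · intro ρ hρ
      simp only [coe_filter, mem_univ, true_and, Set.mem_ofPred_eq, Equiv.trans_apply,
        Equiv.swap_apply_right] at hρ ⊢
      exact fun y hy => hρ _ (hsw y hy)
    · intro ρ _; ext; simp
    · intro ρ _; ext; simp
  have htot : (univ : Finset (α ≃ Fin N)) =
      M.biUnion fun z => univ.filter fun ρ : α ≃ Fin N => ∀ y ∈ M, ρ z ≤ ρ y := by
    ext ρ
    simp only [mem_univ, mem_biUnion, mem_filter, true_and, true_iff]
    exact M.exists_min_image ρ ⟨x, hx⟩
  have hc : Fintype.card (α ≃ Fin N) = ∑ z ∈ M,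
      (univ.filter fun ρ : α ≃ Fin N => ∀ y ∈ M, ρ z ≤ ρ y).card := by
    refine (congrArg Finset.card htot).trans (Finset.card_biUnion ?_)
    intro z hz z' hz' hne
    rw [Function.onFun, Finset.disjoint_left]
    intro ρ h1 h2
    simp only [mem_filter, mem_univ, true_and] at h1 h2
    exact hne (ρ.injective (le_antisymm (h1 z' hz') (h2 z hz)))
  rw [Nat.card_eq_fintype_card, Nat.card_eq_fintype_card, Fintype.card_subtype, hc,
    Finset.sum_congr rfl hsymm]
  simp [mul_comm]

lemma numKmers_cnd {σ k w p a d : ℕ} (hwk : w ≤ k) (v : Fin (w + k) → Fin σ)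
    (h : Cnd (wext v) k w p a d) : (univ.image (kmerAt σ k w v)).card = a + d + p := by
  classical
  have hle := h.le
  have hp := h.pos
  let R : Finset (Fin (w + 1)) := univ.filter fun i => i.1 < a + p ∨ w - d < i.1
  have himg : univ.image (kmerAt σ k w v) = R.image (kmerAt σ k w v) := by
    apply Finset.Subset.antisymm _ (Finset.image_subset_image (Finset.subset_univ _))
    intro y hy
    obtain ⟨i, -, rfl⟩ := Finset.mem_image.1 hy
    have hi := i.2
    by_cases hR : i.1 < a + p ∨ w - d < i.1
    · exact Finset.mem_image_of_mem _ (by simp [R, hR])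
    · have hm := Nat.mod_lt (i.1 - a) (show p > 0 from hp)
      have hdm := Nat.div_add_mod (i.1 - a) p
      have hj : a + (i.1 - a) % p < w + 1 := by omega
      refine Finset.mem_image.2 ⟨⟨a + (i.1 - a) % p, hj⟩, by simp [R, hm], ?_⟩
      rw [kmer_eq_iff]
      have := cnd_conv h (i := a + (i.1 - a) % p) (m := (i.1 - a) / p) (by omega)
        (by rw [mul_comm]; omega)
      rw [mul_comm] at this
      rwa [show a + (i.1 - a) % p + p * ((i.1 - a) / p) = i.1 by omega] at this
  have hinj : Set.InjOn (kmerAt σ k w v) R := by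
    have key : ∀ i ∈ R, ∀ j ∈ R, i.1 < j.1 → kmerAt σ k w v i ≠ kmerAt σ k w v j := by
      intro i hi j hj hij he
      simp only [R, mem_filter, mem_univ, true_and] at hi hj
      have hj2 := j.2
      obtain ⟨h1, h2, h3⟩ := cnd_key hwk h hij (by omega) ((kmer_eq_iff v i j).1 he)
      have := Nat.le_of_dvd (by omega) h3
      omega
    intro i hi j hj he
    rcases lt_trichotomy i.1 j.1 with hl | hl | hl
    · exact absurd he (key i hi j hj hl)
    · exact Fin.ext hl
    · exact absurd he.symm (key j hj i hi hl)
  rw [himg, Finset.card_image_of_injOn hinj]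
  have : R.map Fin.valEmbedding = range (a + p) ∪ Ico (w - d + 1) (w + 1) := by
    ext x
    simp only [R, Finset.mem_map, mem_filter, mem_univ, true_and, Fin.valEmbedding_apply, mem_union,
      mem_range, mem_Ico]
    constructor
    · rintro ⟨i, hi, rfl⟩
      have := i.2
      omega
    · intro hx
      exact ⟨⟨x, by omega⟩, by simp only; omega, rfl⟩
  rw [← Finset.card_map Fin.valEmbedding, this, Finset.card_union_of_disjoint]
  · simp; omega
  · rw [Finset.disjoint_left]
    intro x h1 h2
    simp at h1 h2
    omega

lemma Pgc_cnd {σ k w p a d : ℕ} (hw : 1 ≤ w) (hwk : w ≤ k) (v : Fin (w + k) → Fin σ)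
    (h : Cnd (wext v) k w p a d) :
    Pgc σ k w v = (if d = 0 then 1 else 2) / ((a + d + p : ℕ) : ℝ) := by
  classical
  have hle := h.le
  have hp := h.pos
  have hM := numKmers_cnd hwk v h
  set M := univ.image (kmerAt σ k w v) with hMd
  have hmem : ∀ i, kmerAt σ k w v i ∈ M := fun i => Finset.mem_image_of_mem _ (mem_univ _)
  have hall : ∀ (ρ : (Fin k → Fin σ) ≃ Fin (σ ^ k)) z,
      (∀ i, ρ z ≤ ρ (kmerAt σ k w v i)) ↔ ∀ y ∈ M, ρ z ≤ ρ y := by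
    intro ρ z; simp [hMd]
  have hN : 0 < Nat.card ((Fin k → Fin σ) ≃ Fin (σ ^ k)) := by
    rw [Nat.card_pos_iff]
    exact ⟨⟨Fintype.equivFinOfCardEq (by simp)⟩, inferInstance⟩
  have c0 := card_min (N := σ ^ k) M (hmem 0)
  have c1 := card_min (N := σ ^ k) M (hmem (Fin.last w))
  rw [hM] at c0 c1
  unfold Pgc
  have hNr : (Nat.card ((Fin k → Fin σ) ≃ Fin (σ ^ k)) : ℝ) ≠ 0 := by positivity
  have htr : ((a + d + p : ℕ) : ℝ) ≠ 0 := by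
    have : 0 < a + d + p := by omega
    positivity
  rw [div_eq_div_iff hNr htr]
  by_cases hd : d = 0
  · have hGC : ∀ ρ, IsGC σ k w ρ v ↔ ∀ y ∈ M, ρ (kmerAt σ k w v 0) ≤ ρ y := by
      intro ρ
      rw [← hall, IsGC, or_iff_left]
      rintro ⟨-, hu⟩
      have := hu ⟨w - p, by omega⟩ ?_
      · have := congrArg Fin.val this
        simp at this; omega
      · rw [kmer_eq_iff]
        have := cnd_conv h (i := w - p) (m := 1) (by omega) (by omega)
        simpa [show w - p + p = w by omega] using this
    simp only [hGC, hd, if_true, one_mul]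
    subst hd
    exact_mod_cast c0
  · have huniq : ∀ i, kmerAt σ k w v i = kmerAt σ k w v (Fin.last w) → i = Fin.last w := by
      intro i hi
      by_contra hne
      have hlt : i.1 < (Fin.last w).1 := Fin.lt_last_iff_ne_last.2 hne
      have := cnd_key hwk h hlt (by simp) ((kmer_eq_iff v _ _).1 hi)
      simp at this; omega
    have hGC : ∀ ρ, IsGC σ k w ρ v ↔ (∀ y ∈ M, ρ (kmerAt σ k w v 0) ≤ ρ y) ∨
        (∀ y ∈ M, ρ (kmerAt σ k w v (Fin.last w)) ≤ ρ y) := by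
      intro ρ
      rw [← hall, ← hall, IsGC, and_iff_left huniq]
    have hsum : Nat.card {ρ : (Fin k → Fin σ) ≃ Fin (σ ^ k) // IsGC σ k w ρ v} =
        Nat.card {ρ : (Fin k → Fin σ) ≃ Fin (σ ^ k) // ∀ y ∈ M, ρ (kmerAt σ k w v 0) ≤ ρ y} +
        Nat.card {ρ : (Fin k → Fin σ) ≃ Fin (σ ^ k) //
          ∀ y ∈ M, ρ (kmerAt σ k w v (Fin.last w)) ≤ ρ y} := by
      simp only [hGC, Nat.card_eq_fintype_card, Fintype.card_subtype]
      rw [← Finset.card_union_of_disjoint, Finset.filter_or]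
      rw [Finset.disjoint_left]
      intro ρ h1 h2
      simp only [mem_filter, mem_univ, true_and] at h1 h2
      have := ρ.injective (le_antisymm (h1 _ (hmem _)) (h2 _ (hmem _)))
      have := congrArg Fin.val (huniq _ this)
      simp at this; omega
    rw [hsum]
    simp only [hd, if_false]
    have : (Nat.card {ρ : (Fin k → Fin σ) ≃ Fin (σ ^ k) // ∀ y ∈ M, ρ (kmerAt σ k w v 0) ≤ ρ y} +
        Nat.card {ρ : (Fin k → Fin σ) ≃ Fin (σ ^ k) //
          ∀ y ∈ M, ρ (kmerAt σ k w v (Fin.last w)) ≤ ρ y}) * (a + d + p) =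
        2 * Nat.card ((Fin k → Fin σ) ≃ Fin (σ ^ k)) := by
      rw [add_mul, c0, c1]; ring
    exact_mod_cast this

lemma per_mod {V : ℕ → ℕ} {a r p : ℕ} (h : Per V a r p) {x : ℕ} (h1 : a ≤ x)
    (h2 : x < r) : V (a + (x - a) % p) = V x := by
  have hdm := Nat.div_add_mod' (x - a) p
  rw [per_mul h ((x - a) / p) (a + (x - a) % p) (by omega) (by omega)]
  congr 1; omega

lemma prim_iff {σ p a : ℕ} {V : ℕ → ℕ} (s : Fin p → Fin σ)
    (hs : ∀ i : Fin p, V (a + i.1) = (s i).1) :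
    IsPrimitive σ p s ↔ ¬ ∃ g, g ∣ p ∧ g < p ∧ Per V a (a + p) g := by
  have : ∀ g, HasPeriod σ p s g ↔ Per V a (a + p) g := by
    intro g
    constructor
    · intro h x h1 h2
      have := h (x - a) (by omega)
      have e1 := hs ⟨x - a, by omega⟩
      have e2 := hs ⟨x - a + g, by omega⟩
      simp only at e1 e2
      rw [show a + (x - a) = x by omega] at e1
      rw [show a + (x - a + g) = x + g by omega] at e2
      rw [e1, e2, this]
    · intro h i hi
      have := h (a + i) (by omega) (by omega)
      have e1 := hs ⟨i, by omega⟩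
      have e2 := hs ⟨i + g, by omega⟩
      simp only at e1 e2
      apply Fin.ext
      rw [← e1, ← e2, this]; congr 1; omega
  simp only [IsPrimitive, this]

lemma cnd_iff {σ k w p a d : ℕ} (hp : 0 < p) (hle : a + d + p ≤ w) (hwk : w ≤ k) {V : ℕ → ℕ}
    (s : Fin p → Fin σ)
    (l : Fin a → Fin σ) (r : Fin d → Fin σ) (hs : ∀ i : Fin p, V (a + i.1) = (s i).1)
    (hl : ∀ i : Fin a, V i.1 = (l i).1) (hr : ∀ i : Fin d, V (w + k - d + i.1) = (r i).1)
    (hper : Per V a (w + k - d) p) :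
    Cnd V k w p a d ↔ IsPrimitive σ p s ∧ (∀ i : Fin a, i.1 + 1 = a → l i ≠ s ⟨p - 1, by omega⟩) ∧
      (∀ i : Fin d, i.1 = 0 → r i ≠ s ⟨(w + k - d - p - a) % p, Nat.mod_lt _ hp⟩) := by
  have hS : V (w + k - d - p) = (s ⟨(w + k - d - p - a) % p, Nat.mod_lt _ hp⟩).1 := by
    rw [← hs, per_mod hper (by omega) (by omega)]
  have hS' : V (a + (p - 1)) = (s ⟨p - 1, by omega⟩).1 := by
    rw [← hs]
  rw [prim_iff s hs]
  constructor
  · intro h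
    refine ⟨h.prim, ?_, ?_⟩
    · intro i hi he
      apply h.left i.1 hi
      rw [hl, he, ← hS']; congr 1; omega
    · intro i hi he
      apply h.right (w + k - d - p) (by omega) (by have := i.2; omega)
      rw [hS, ← he, ← hr]; congr 1; omega
  · rintro ⟨h1, h2, h3⟩
    refine ⟨hp, hle, hper, ?_, ?_, h1⟩
    · intro x hx he
      apply h2 ⟨x, by omega⟩ hx
      apply Fin.ext
      rw [← hl, ← hS']
      simp only
      rw [he]; congr 1; omega
    · intro x hx hd he
      obtain rfl : x = w + k - d - p := by omega
      apply h3 ⟨0, hd⟩ rfl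
      apply Fin.ext
      rw [← hr, ← hS, he]
      congr 1
      simp only; omega

def Lc (σ : ℕ) : ℕ → ℕ
  | 0 => 1
  | (m + 1) => (σ - 1) * σ ^ m

lemma card_one_ne {σ m : ℕ} (i0 : ℕ) (hi0 : m ≠ 0 → i0 < m) (c : Fin σ) (P : Fin m → Prop)
    [DecidablePred P] (hP : ∀ i, P i ↔ i.1 = i0) :
    (univ.filter fun l : Fin m → Fin σ => ∀ i, P i → l i ≠ c).card = Lc σ m := by
  have : (univ.filter fun l : Fin m → Fin σ => ∀ i, P i → l i ≠ c) =
      Fintype.piFinset fun i : Fin m => if i.1 = i0 then univ.erase c else univ := by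
    ext l
    simp only [mem_filter, mem_univ, true_and, Fintype.mem_piFinset]
    refine forall_congr' fun i => ?_
    rw [hP]
    split_ifs with h <;> simp [h]
  rw [this, Fintype.card_piFinset]
  cases m with
  | zero => simp [Lc]
  | succ m =>
    have h0 := hi0 (by omega)
    rw [← Finset.mul_prod_erase univ _ (mem_univ (⟨i0, h0⟩ : Fin (m + 1)))]
    rw [Finset.prod_congr rfl (g := fun _ => σ)]
    · simp [Lc]
    · intro i hi
      rw [if_neg]
      · simp
      · intro h
        exact (Finset.ne_of_mem_erase hi) (Fin.ext h)

lemma card_cnd {σ k w p a d : ℕ} (hwk : w ≤ k) (hp : 0 < p)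
    (hle : a + d + p ≤ w) [DecidablePred fun v : Fin (w + k) → Fin σ => Cnd (wext v) k w p a d] :
    (univ.filter fun v : Fin (w + k) → Fin σ => Cnd (wext v) k w p a d).card =
      Prim σ p * (Lc σ a * Lc σ d) := by
  classical
  let T : Finset (Σ _ : (Fin p → Fin σ), (Fin a → Fin σ) × (Fin d → Fin σ)) :=
    (univ.filter fun s => IsPrimitive σ p s).sigma fun s =>
      (univ.filter fun l : Fin a → Fin σ => ∀ i, i.1 + 1 = a → l i ≠ s ⟨p - 1, by omega⟩) ×ˢ
      (univ.filter fun r : Fin d → Fin σ => ∀ i, i.1 = 0 →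
        r i ≠ s ⟨(w + k - d - p - a) % p, Nat.mod_lt _ hp⟩)
  have hT : T.card = Prim σ p * (Lc σ a * Lc σ d) := by
    simp only [T, Finset.card_sigma, Finset.card_product]
    rw [Finset.sum_congr rfl (g := fun _ => Lc σ a * Lc σ d)]
    · rw [Finset.sum_const, Prim, Nat.card_eq_fintype_card, Fintype.card_subtype, smul_eq_mul]
    · intro s _
      rw [card_one_ne (a - 1) (by omega) _ (fun i : Fin a => i.1 + 1 = a) (by intro i; omega),
        card_one_ne 0 (by omega) _ (fun i : Fin d => i.1 = 0) (by intro i; rfl)]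
  rw [← hT]
  let f : (Fin (w + k) → Fin σ) → (Σ _ : (Fin p → Fin σ), (Fin a → Fin σ) × (Fin d → Fin σ)) :=
    fun v => ⟨fun i => v ⟨a + i.1, by omega⟩, fun i => v ⟨i.1, by omega⟩,
      fun i => v ⟨w + k - d + i.1, by omega⟩⟩
  let g : (Σ _ : (Fin p → Fin σ), (Fin a → Fin σ) × (Fin d → Fin σ)) → (Fin (w + k) → Fin σ) :=
    fun t x => if h : x.1 < a then t.2.1 ⟨x.1, h⟩ else if h2 : x.1 < w + k - d then
      t.1 ⟨(x.1 - a) % p, Nat.mod_lt _ hp⟩ else t.2.2 ⟨x.1 - (w + k - d), by omega⟩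
  have hfg : ∀ t, f (g t) = t := by
    rintro ⟨s, l, r⟩
    have e1 : (f (g ⟨s, l, r⟩)).1 = s := by
      funext i
      have := i.2
      simp only [f, g]
      rw [dif_neg (by omega), dif_pos (by omega)]
      congr 1
      apply Fin.ext
      simp [Nat.mod_eq_of_lt i.2]
    have e2 : (f (g ⟨s, l, r⟩)).2.1 = l := by
      funext i
      simp only [f, g]
      rw [dif_pos (by omega)]
    have e3 : (f (g ⟨s, l, r⟩)).2.2 = r := by
      funext i
      simp only [f, g]
      rw [dif_neg (by omega), dif_neg (by omega)]
      congr 1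
      apply Fin.ext
      simp
    exact Sigma.ext e1 (heq_of_eq (Prod.ext e2 e3))
  have hmem : ∀ v, Per (wext v) a (w + k - d) p → (Cnd (wext v) k w p a d ↔ f v ∈ T) := by
    intro v hper
    rw [cnd_iff hp hle hwk (f v).1 (f v).2.1 (f v).2.2 _ _ _ hper]
    · simp only [T, Finset.mem_sigma, Finset.mem_product, mem_filter, mem_univ, true_and]
    · intro i; rw [wext_lt v (show a + i.1 < w + k by omega)]
    · intro i; rw [wext_lt v (show i.1 < w + k by omega)]
    · intro i; rw [wext_lt v (show w + k - d + i.1 < w + k by omega)]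
  refine Finset.card_nbij' f g ?_ ?_ ?_ ?_
  · intro v hv
    simp only [coe_filter, mem_univ, true_and, Set.mem_ofPred_eq] at hv
    exact (hmem v hv.per).1 hv
  · intro t ht
    simp only [coe_filter, mem_univ, true_and, Set.mem_ofPred_eq]
    refine (hmem (g t) ?_).2 (by rw [hfg]; exact ht)
    intro x h1 h2
    rw [wext_lt _ (show x < w + k by omega), wext_lt _ (show x + p < w + k by omega)]
    simp only [g]
    rw [dif_neg (by omega), dif_pos (by omega), dif_neg (by omega), dif_pos (by omega)]
    have hmm : (x + p - a) % p = (x - a) % p := by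
      rw [show x + p - a = x - a + p by omega, Nat.add_mod_right]
    simp only [hmm]
  · intro v hv
    simp only [coe_filter, mem_univ, true_and, Set.mem_ofPred_eq] at hv
    funext x
    have hx := x.2
    simp only [f, g]
    split_ifs with h1 h2
    · rfl
    · have := per_mod hv.per (x := x.1) (by omega) h2
      have hm := Nat.mod_lt (x.1 - a) hp
      rw [wext_lt v (show a + (x.1 - a) % p < w + k by omega), wext_lt v hx] at this
      exact Fin.ext this
    · congr 1
      apply Fin.ext
      simp only; omega
  · intro t _
    exact hfg t

lemma sum_anti {σ : ℕ} (hσ : 2 ≤ σ) (m : ℕ) :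
    ∑ x ∈ antidiagonal (m + 1), ((Lc σ x.1 * Lc σ x.2 : ℕ) : ℝ) * (if x.2 = 0 then 1 else 2) =
      (σ : ℝ) ^ (m + 1) * (2 * ((m + 1 : ℕ) : ℝ) + 1 - (4 * ((m + 1 : ℕ) : ℝ) - 1) / σ +
        (2 * ((m + 1 : ℕ) : ℝ) - 2) / (σ : ℝ) ^ 2) := by
  have h0 : (σ : ℝ) ≠ 0 := by positivity
  have h1 : ((σ - 1 : ℕ) : ℝ) = σ - 1 := by push_cast [show 1 ≤ σ by omega]; rfl
  rw [Finset.Nat.sum_antidiagonal_eq_sum_range_succ_mk, Finset.sum_range_succ, Finset.sum_range_succ']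
  rw [Finset.sum_congr rfl (g := fun _ => 2 * ((σ : ℝ) - 1) ^ 2 * (σ : ℝ) ^ (m - 1))]
  · simp only [Lc, Finset.sum_const, card_range, Nat.sub_self, Nat.sub_zero, if_true,
      Nat.succ_ne_zero, if_false, nsmul_eq_mul]
    push_cast [h1]
    cases m with
    | zero => field_simp; push_cast; ring
    | succ m => simp only [Nat.add_sub_cancel]; push_cast; field_simp; ring
  · intro i hi
    rw [mem_range] at hi
    obtain ⟨j, hj⟩ : ∃ j, m + 1 - (i + 1) = j + 1 := ⟨m - i - 1, by omega⟩
    simp only [hj, Lc, Nat.succ_ne_zero, if_false]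
    push_cast [h1]
    rw [show m - 1 = i + j by omega, pow_add]
    ring

theorem stmt7 (σ k w : ℕ) (hσ : 2 ≤ σ) (hw : 1 ≤ w) (hwk : w ≤ k) :
    ∑ v ∈ RepSet σ k w, Pgc σ k w v =
      ∑ t ∈ Finset.Icc 1 w, (1 / (t : ℝ)) *
        ((Prim σ t : ℝ) + ∑ p ∈ Finset.Ico 1 t, (Prim σ p : ℝ) * (σ : ℝ) ^ (t - p) *
          (2 * (t : ℝ) - 2 * p + 1 - (4 * (t : ℝ) - 4 * p - 1) / σ +
            (2 * (t : ℝ) - 2 * p - 2) / (σ : ℝ) ^ 2)) := by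
  classical
  let I : Finset (Σ _ : ℕ, Σ _ : ℕ, ℕ × ℕ) :=
    (Icc 1 w).sigma fun t => (Icc 1 t).sigma fun p => antidiagonal (t - p)
  have hI : ∀ x ∈ I, 1 ≤ x.2.1 ∧ x.2.2.1 + x.2.2.2 + x.2.1 = x.1 ∧ x.1 ≤ w := by
    rintro ⟨t, p, a, d⟩ hx
    simp only [I, Finset.mem_sigma, mem_Icc, HasAntidiagonal.mem_antidiagonal] at hx
    simp only
    omega
  have hRep : RepSet σ k w = I.biUnion fun x =>
      univ.filter fun v : Fin (w + k) → Fin σ => Cnd (wext v) k w x.2.1 x.2.2.1 x.2.2.2 := by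
    ext v
    simp only [RepSet, mem_filter, mem_univ, true_and, mem_biUnion]
    constructor
    · rintro ⟨i, j, hne, he⟩
      have hi := i.2
      have hj := j.2
      have : ∃ p a d, Cnd (wext v) k w p a d := by
        rw [kmer_eq_iff] at he
        rcases lt_or_gt_of_ne (fun h => hne (Fin.ext h) : i.1 ≠ j.1) with h | h
        · exact cnd_exists hwk h (by omega) he
        · exact cnd_exists hwk h (by omega) (fun x hx => (he x hx).symm)
      obtain ⟨p, a, d, h⟩ := this
      have h1 := h.pos
      have h2 := h.le
      refine ⟨⟨a + d + p, p, a, d⟩, ?_, h⟩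
      simp only [I, Finset.mem_sigma, mem_Icc, HasAntidiagonal.mem_antidiagonal]
      omega
    · rintro ⟨⟨t, p, a, d⟩, hx, h⟩
      simp only at h
      have h1 := h.pos
      have h2 := h.le
      refine ⟨⟨a, by omega⟩, ⟨a + p, by omega⟩, ?_, ?_⟩
      · intro he
        have := congrArg Fin.val he
        simp only at this
        omega
      · rw [kmer_eq_iff]
        have := cnd_conv h (i := a) (m := 1) le_rfl (by omega)
        simpa using this
  rw [hRep, Finset.sum_biUnion]
  · have hterm : ∀ x ∈ I, ∑ v ∈ univ.filter fun v : Fin (w + k) → Fin σ =>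
          Cnd (wext v) k w x.2.1 x.2.2.1 x.2.2.2, Pgc σ k w v =
        (1 / (x.1 : ℝ)) * ((Prim σ x.2.1 : ℝ) * (((Lc σ x.2.2.1 * Lc σ x.2.2.2 : ℕ) : ℝ) *
          (if x.2.2.2 = 0 then 1 else 2))) := by
      intro x hx
      obtain ⟨h1, h2, h3⟩ := hI x hx
      rw [Finset.sum_congr rfl (g := fun _ => (if x.2.2.2 = 0 then 1 else 2) / (x.1 : ℝ))]
      · rw [Finset.sum_const, card_cnd hwk h1 (by omega), nsmul_eq_mul]
        push_cast
        ring
      · intro v hv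
        rw [Pgc_cnd hw hwk v (Finset.mem_filter.1 hv).2, h2]
    rw [Finset.sum_congr rfl hterm, Finset.sum_sigma]
    refine Finset.sum_congr rfl fun t ht => ?_
    rw [mem_Icc] at ht
    simp only
    rw [← Finset.mul_sum, Finset.sum_sigma]
    congr 1
    simp only
    rw [← Finset.Ico_insert_right ht.1, Finset.sum_insert (by simp)]
    congr 1
    · simp [Lc]
    · refine Finset.sum_congr rfl fun p hp => ?_
      rw [mem_Ico] at hp
      rw [← Finset.mul_sum]
      obtain ⟨m, rfl⟩ : ∃ m, t = p + (m + 1) := ⟨t - p - 1, by omega⟩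
      rw [Nat.add_sub_cancel_left, sum_anti hσ m, mul_assoc]
      push_cast
      ring
  · intro x hx y hy hne
    rw [Function.onFun, Finset.disjoint_left]
    intro v h1 h2
    have hu := cnd_unique hwk (Finset.mem_filter.1 h1).2 (Finset.mem_filter.1 h2).2
    have e1 := hI x hx
    have e2 := hI y hy
    obtain ⟨t, p, a, d⟩ := x
    obtain ⟨t', p', a', d'⟩ := y
    simp only at hu e1 e2
    apply hne
    obtain ⟨rfl, rfl, rfl⟩ := hu
    obtain rfl : t = t' := by omega
    rfl
end
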